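/- For all real numbers a, b, c, with U(a,b,c) := exp(−(i/2)(a·σx⊗σx + b·σy⊗σy + c·σz⊗σz)), the identity U(a, b, π/2 + c) = −i · (σz ⊗ I₂) · conj(U(a, b, π/2 − c)) · (I₂ ⊗ σz) holds, where conj denotes entrywise complex conjugation of the matrix and I₂ is the 2×2 identity matrix. -/

import Mathlib

open Matrix Kronecker Complex

noncomputable def σx : Matrix (Fin 2) (Fin 2) ℂ := !![0, 1; 1, 0]
noncomputable def σy : Matrix (Fin 2) (Fin 2) ℂ := !![0, -I; I, 0]
noncomputable def σz : Matrix (Fin 2) (Fin 2) ℂ := !![1, 0; 0, -1]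

/-- The two-qubit interaction unitary `U(a,b,c)`. -/
noncomputable def Uint (a b c : ℝ) : Matrix (Fin 2 × Fin 2) (Fin 2 × Fin 2) ℂ :=
  NormedSpace.exp
    (-(I / 2) • ((a : ℂ) • (σx ⊗ₖ σx) + (b : ℂ) • (σy ⊗ₖ σy) + (c : ℂ) • (σz ⊗ₖ σz)))

lemma aux_ZZ : NormedSpace.exp ((-(I / 2) * (Real.pi : ℂ)) • (σz ⊗ₖ σz)) = (-I) • (σz ⊗ₖ σz) := by
  have h : σz ⊗ₖ σz = Matrix.diagonal (fun p : Fin 2 × Fin 2 => if p.1 = p.2 then (1 : ℂ) else -1) := by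
    ext ⟨i, j⟩ ⟨k, l⟩
    fin_cases i <;> fin_cases j <;> fin_cases k <;> fin_cases l <;>
      simp [σz, Matrix.diagonal]
  have e1 : Complex.exp (-(I / 2) * (Real.pi : ℂ)) = -I := by
    rw [show -(I / 2) * (Real.pi : ℂ) = -(Real.pi / 2 * I) by ring, Complex.exp_neg,
      Complex.exp_pi_div_two_mul_I, Complex.inv_I]
  have e2 : Complex.exp (-(-(I / 2) * (Real.pi : ℂ))) = I := by
    rw [Complex.exp_neg, e1, inv_neg, Complex.inv_I, neg_neg]
  rw [h, ← Matrix.diagonal_smul, Matrix.exp_diagonal, ← Matrix.diagonal_smul]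
  congr 1
  funext p
  rw [Pi.coe_exp, ← Complex.exp_eq_exp_ℂ]
  by_cases hp : p.1 = p.2
  · simpa [hp] using e1
  · simpa [hp] using e2

lemma aux_conj (a b c : ℝ) : (Uint a b c).map (starRingEnd ℂ) = NormedSpace.exp
    ((I / 2) • ((a : ℂ) • (σx ⊗ₖ σx) + (b : ℂ) • (σy ⊗ₖ σy) + (c : ℂ) • (σz ⊗ₖ σz))) := by
  have h : ∀ A : Matrix (Fin 2 × Fin 2) (Fin 2 × Fin 2) ℂ, A.map (starRingEnd ℂ) = Aᴴᵀ := by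
    intro A; ext i j; simp
  rw [h, Uint, ← Matrix.exp_conjTranspose, ← Matrix.exp_transpose]
  congr 1
  ext ⟨i, j⟩ ⟨k, l⟩
  fin_cases i <;> fin_cases j <;> fin_cases k <;> fin_cases l <;>
    simp [σx, σy, σz] <;> ring

lemma aux_mul : (σz ⊗ₖ (1 : Matrix (Fin 2) (Fin 2) ℂ)) * (σz ⊗ₖ (1 : Matrix (Fin 2) (Fin 2) ℂ)) = 1 := by
  rw [← Matrix.mul_kronecker_mul]
  have : σz * σz = 1 := by
    ext i j; fin_cases i <;> fin_cases j <;> simp [σz]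
  simp [this]

lemma aux_flip (a b c : ℝ) : (σz ⊗ₖ (1 : Matrix (Fin 2) (Fin 2) ℂ)) *
      (Uint a b c).map (starRingEnd ℂ) =
    Uint a b (-c) * (σz ⊗ₖ (1 : Matrix (Fin 2) (Fin 2) ℂ)) := by
  rw [aux_conj]
  let u : (Matrix (Fin 2 × Fin 2) (Fin 2 × Fin 2) ℂ)ˣ := ⟨_, _, aux_mul, aux_mul⟩
  have h := Matrix.exp_units_conj u
    ((I / 2) • ((a : ℂ) • (σx ⊗ₖ σx) + (b : ℂ) • (σy ⊗ₖ σy) + (c : ℂ) • (σz ⊗ₖ σz)))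
  have hx : σz * σx = -(σx * σz) := by
    ext i j; fin_cases i <;> fin_cases j <;> simp [σz, σx]
  have hy : σz * σy = -(σy * σz) := by
    ext i j; fin_cases i <;> fin_cases j <;> simp [σz, σy]
  have hn : ∀ A B : Matrix (Fin 2) (Fin 2) ℂ, (-A) ⊗ₖ B = -(A ⊗ₖ B) := by
    intro A B; ext i j; simp
  have h2 : (u : Matrix (Fin 2 × Fin 2) (Fin 2 × Fin 2) ℂ) *
      ((I / 2) • ((a : ℂ) • (σx ⊗ₖ σx) + (b : ℂ) • (σy ⊗ₖ σy) + (c : ℂ) • (σz ⊗ₖ σz)))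
      = (-(I / 2) • ((a : ℂ) • (σx ⊗ₖ σx) + (b : ℂ) • (σy ⊗ₖ σy) + ((-c : ℝ) : ℂ) • (σz ⊗ₖ σz))) * u := by
    simp only [u, mul_add, add_mul, smul_mul_assoc, mul_smul_comm, ← Matrix.mul_kronecker_mul,
      hx, hy, hn, one_mul, mul_one]
    push_cast
    module
  rw [h2, Units.mul_inv_cancel_right] at h
  rw [Uint, h]
  exact (Units.inv_mul_cancel_right _ u).symm

theorem Uint_pi_div_two_add_conj (a b c : ℝ) :
    Uint a b (Real.pi / 2 + c)
      = (-I) • ((σz ⊗ₖ (1 : Matrix (Fin 2) (Fin 2) ℂ)) *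
          (Uint a b (Real.pi / 2 - c)).map (starRingEnd ℂ) *
          ((1 : Matrix (Fin 2) (Fin 2) ℂ) ⊗ₖ σz)) := by
  rw [aux_flip, mul_assoc, ← Matrix.mul_kronecker_mul, mul_one, one_mul, ← mul_smul_comm, ← aux_ZZ,
    Uint, Uint, ← Matrix.exp_add_of_commute]
  · congr 1
    push_cast
    module
  · have hx : Commute (σx ⊗ₖ σx) (σz ⊗ₖ σz) := by
      rw [Commute, SemiconjBy, ← Matrix.mul_kronecker_mul, ← Matrix.mul_kronecker_mul]
      ext ⟨i, j⟩ ⟨k, l⟩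
      fin_cases i <;> fin_cases j <;> fin_cases k <;> fin_cases l <;> simp [σx, σz]
    have hy : Commute (σy ⊗ₖ σy) (σz ⊗ₖ σz) := by
      rw [Commute, SemiconjBy, ← Matrix.mul_kronecker_mul, ← Matrix.mul_kronecker_mul]
      ext ⟨i, j⟩ ⟨k, l⟩
      fin_cases i <;> fin_cases j <;> fin_cases k <;> fin_cases l <;> simp [σy, σz]
    exact (((((hx.smul_left _).add_left (hy.smul_left _)).add_left
      ((Commute.refl _).smul_left _)).smul_left _).smul_right _)
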